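/- arXiv:2507.01148 — 6 statements merged into one kernel-verified Lean document; each statement's English description precedes it below -/
import Mathlib

section
/- Let k ≥ 1 and let i_1,…,i_k, j_1,…,j_k be positive integers. Then ‖A_2^{j_k} A_1^{i_k} ⋯ A_2^{j_1} A_1^{i_1}‖ ≥ (1 + i_1 j_1)(1 + i_2 j_2) ⋯ (1 + i_k j_k), where ‖·‖ is the operator norm on 2×2 real matrices induced by the Euclidean norm on ℝ². -/
/-- The parabolic matrix `A₁ = [[1,0],[1,1]]`. -/
def A1 : Matrix (Fin 2) (Fin 2) ℝ := !![1, 0; 1, 1]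

/-- The parabolic matrix `A₂ = [[1,1],[0,1]]`. -/
def A2 : Matrix (Fin 2) (Fin 2) ℝ := !![1, 1; 0, 1]

/-- The operator norm on 2×2 real matrices induced by the Euclidean norm on `ℝ²`. -/
noncomputable def opNorm (M : Matrix (Fin 2) (Fin 2) ℝ) : ℝ :=
  ‖Matrix.toEuclideanCLM (𝕜 := ℝ) M‖

theorem A1_pow (n : ℕ) : A1 ^ n = !![1, 0; (n : ℝ), 1] := by
  induction n with
  | zero => ext a b; fin_cases a <;> fin_cases b <;> simp
  | succ n ih =>
    rw [pow_succ, ih, A1]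
    ext a b; fin_cases a <;> fin_cases b <;> simp [Matrix.mul_apply, Fin.sum_univ_two]

theorem A2_pow (n : ℕ) : A2 ^ n = !![1, (n : ℝ); 0, 1] := by
  induction n with
  | zero => ext a b; fin_cases a <;> fin_cases b <;> simp
  | succ n ih =>
    rw [pow_succ, ih, A2]
    ext a b; fin_cases a <;> fin_cases b <;>
      simp [Matrix.mul_apply, Fin.sum_univ_two, add_comm]

theorem block_eq (m n : ℕ) :
    A2 ^ n * A1 ^ m = !![1 + (m : ℝ) * n, (n : ℝ); (m : ℝ), 1] := by
  rw [A1_pow, A2_pow]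
  ext a b; fin_cases a <;> fin_cases b <;>
    simp [Matrix.mul_apply, Fin.sum_univ_two, mul_comm]

theorem entry_bound (k : ℕ) (i j : Fin k → ℕ) :
    (∏ l : Fin k, (1 + (i l : ℝ) * (j l : ℝ)))
      ≤ (((List.ofFn fun l : Fin k => A2 ^ (j l) * A1 ^ (i l)).reverse).prod) 0 0 ∧
    0 ≤ (((List.ofFn fun l : Fin k => A2 ^ (j l) * A1 ^ (i l)).reverse).prod) 0 1 := by
  induction k with
  | zero => simp
  | succ k ih =>
    obtain ⟨h1, h2⟩ := ih (fun l => i l.succ) (fun l => j l.succ)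
    rw [List.ofFn_succ, List.reverse_cons, List.prod_append, List.prod_singleton,
      Fin.prod_univ_succ, block_eq]
    have hp : 0 ≤ ∏ l : Fin k, (1 + (i l.succ : ℝ) * (j l.succ : ℝ)) :=
      Finset.prod_nonneg fun l _ => by positivity
    generalize (List.ofFn fun l : Fin k =>
      A2 ^ (j l.succ) * A1 ^ (i l.succ)).reverse.prod = M at h1 h2 ⊢
    have h3 := hp.trans h1
    simp only [Matrix.mul_apply, Fin.sum_univ_two]
    simp
    constructor
    · have e1 : (0:ℝ) ≤ 1 + (i 0 : ℝ) * j 0 := by positivity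
      have := mul_le_mul_of_nonneg_left h1 e1
      have := mul_nonneg h2 (Nat.cast_nonneg (α := ℝ) (i 0))
      linarith
    · positivity

theorem entry_le_opNorm (M : Matrix (Fin 2) (Fin 2) ℝ) : M 0 0 ≤ opNorm M := by
  have h := (Matrix.toEuclideanCLM (𝕜 := ℝ) M).le_opNorm (EuclideanSpace.single 0 1)
  have h2 := PiLp.norm_apply_le
    (Matrix.toEuclideanCLM (𝕜 := ℝ) M (EuclideanSpace.single 0 1)) 0
  have h3 : (Matrix.toEuclideanCLM (𝕜 := ℝ) M (EuclideanSpace.single 0 1)) 0 = M 0 0 := by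
    simp [Matrix.ofLp_toEuclideanCLM]
  rw [h3] at h2
  simp only [EuclideanSpace.norm_single, norm_one, mul_one] at h
  exact (le_abs_self _).trans (h2.trans h)


/-- For `k ≥ 1` and positive integers `i₁,…,i_k, j₁,…,j_k`,
`‖A₂^{j_k} A₁^{i_k} ⋯ A₂^{j₁} A₁^{i₁}‖ ≥ (1 + i₁ j₁) ⋯ (1 + i_k j_k)`. -/
theorem stmt2 (k : ℕ) (hk : 1 ≤ k) (i j : Fin k → ℕ)
    (hi : ∀ l, 1 ≤ i l) (hj : ∀ l, 1 ≤ j l) :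
    (∏ l : Fin k, (1 + (i l : ℝ) * (j l : ℝ)))
      ≤ opNorm (((List.ofFn fun l : Fin k => A2 ^ (j l) * A1 ^ (i l)).reverse).prod) := by
  exact (entry_bound k i j).1.trans (entry_le_opNorm _)
end

section
/- For every natural number n ≥ 1, ‖A_1^n‖ ≤ n + 1/n and ‖A_2^n‖ ≤ n + 1/n, where ‖·‖ is the operator norm induced by the Euclidean norm on ℝ². -/
theorem aux_bound (M : Matrix (Fin 2) (Fin 2) ℝ) (C : ℝ) (hC : 0 ≤ C)
    (h : ∀ x y : ℝ, (M 0 0 * x + M 0 1 * y) ^ 2 + (M 1 0 * x + M 1 1 * y) ^ 2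
      ≤ C ^ 2 * (x ^ 2 + y ^ 2)) : opNorm M ≤ C := by
  unfold opNorm
  refine ContinuousLinearMap.opNorm_le_bound _ hC fun v => ?_
  refine le_of_sq_le_sq ?_ (by positivity)
  rw [mul_pow, EuclideanSpace.norm_sq_eq, EuclideanSpace.norm_sq_eq]
  simpa [Fin.sum_univ_two, Matrix.mulVec, dotProduct, Matrix.ofLp_toEuclideanCLM] using h (v 0) (v 1)

/-- For every `n ≥ 1`, `‖A₁^n‖ ≤ n + 1/n` and `‖A₂^n‖ ≤ n + 1/n`. -/
theorem stmt5 (n : ℕ) (hn : 1 ≤ n) :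
    opNorm (A1 ^ n) ≤ (n : ℝ) + 1 / (n : ℝ) ∧
      opNorm (A2 ^ n) ≤ (n : ℝ) + 1 / (n : ℝ) := by
  have hpos : (0 : ℝ) < n := by exact_mod_cast hn
  obtain ⟨m, hm⟩ : ∃ m : ℝ, m = 1 / (n : ℝ) := ⟨_, rfl⟩
  have hnm : (n : ℝ) * m = 1 := by rw [hm]; field_simp
  have hm0 : 0 ≤ m := by rw [hm]; positivity
  have key : ∀ x y : ℝ, x ^ 2 + (n * x + y) ^ 2 ≤ ((n : ℝ) + m) ^ 2 * (x ^ 2 + y ^ 2) := by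
    intro x y
    have e : ((n : ℝ) + m) ^ 2 = n ^ 2 + 2 + m ^ 2 := by linear_combination 2 * hnm
    rw [e]
    nlinarith [sq_nonneg (x - n * y), sq_nonneg (m * x), sq_nonneg (m * y), sq_nonneg y]
  rw [← hm]
  constructor
  · refine aux_bound _ _ (by positivity) fun x y => ?_
    rw [A1_pow]
    simpa using key x y
  · refine aux_bound _ _ (by positivity) fun x y => ?_
    rw [A2_pow]
    have := key y x
    simp
    linarith
end

section
/- Let n ≥ 1 and let B_1, …, B_n be 2×2 real matrices, each of the form [[1+mk, k],[m, 1]] for some positive integers m, k. Then ‖(B_n ⋯ B_1) e_1‖ ≥ (1/√2) ‖B_n ⋯ B_1‖, where e_1 = (1,0), the vector norm is the Euclidean norm on ℝ², and ‖·‖ on matrices is the induced operator norm. -/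
/-- Membership in the class `𝒞` of 2×2 real matrices of the form
`[[1 + m k, k],[m, 1]]` with `m, k` positive integers. -/
def InClassC (M : Matrix (Fin 2) (Fin 2) ℝ) : Prop :=
  ∃ m k : ℕ, 1 ≤ m ∧ 1 ≤ k ∧
    M = !![1 + (m : ℝ) * (k : ℝ), (k : ℝ); (m : ℝ), 1]

/-- The Euclidean norm of a vector in `ℝ²`. -/
noncomputable def evNorm (v : Fin 2 → ℝ) : ℝ := Real.sqrt (v 0 ^ 2 + v 1 ^ 2)

lemma aux_prod (L : List (Matrix (Fin 2) (Fin 2) ℝ)) (h : ∀ M ∈ L, InClassC M) (hL : L ≠ []) :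
    0 ≤ L.prod 0 1 ∧ L.prod 0 1 ≤ L.prod 0 0 ∧ 0 ≤ L.prod 1 1 ∧ L.prod 1 1 ≤ L.prod 1 0 := by
  induction L with
  | nil => exact absurd rfl hL
  | cons M T ih =>
    obtain ⟨m, k, hm, hk, hM⟩ := h M (by simp)
    have hm' : (1 : ℝ) ≤ m := by exact_mod_cast hm
    have hk' : (1 : ℝ) ≤ k := by exact_mod_cast hk
    by_cases hT : T = []
    · subst hT
      subst hM
      simp
      refine ⟨by nlinarith, hm⟩
    · obtain ⟨h1, h2, h3, h4⟩ := ih (fun M hM => h M (by simp [hM])) hT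
      subst hM
      simp only [List.prod_cons, Matrix.mul_apply, Fin.sum_univ_two]
      simp
      refine ⟨by positivity, by gcongr, by positivity, by gcongr⟩

lemma aux_norm (M : Matrix (Fin 2) (Fin 2) ℝ) :
    opNorm M ≤ Real.sqrt (M 0 0 ^ 2 + M 0 1 ^ 2 + M 1 0 ^ 2 + M 1 1 ^ 2) := by
  unfold opNorm
  refine ContinuousLinearMap.opNorm_le_bound _ (Real.sqrt_nonneg _) fun x => ?_
  rw [EuclideanSpace.norm_eq, EuclideanSpace.norm_eq, ← Real.sqrt_mul (by positivity)]
  apply Real.sqrt_le_sqrt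
  simp [Fin.sum_univ_two, Matrix.mulVec, dotProduct]
  nlinarith [sq_nonneg (M 0 0 * x 1 - M 0 1 * x 0), sq_nonneg (M 1 0 * x 1 - M 1 1 * x 0)]

/-- For `n ≥ 1` and matrices `B₁, …, Bₙ ∈ 𝒞`,
`‖(Bₙ ⋯ B₁) e₁‖ ≥ (1/√2) ‖Bₙ ⋯ B₁‖` with `e₁ = (1,0)`. -/
theorem stmt8 (n : ℕ) (hn : 1 ≤ n) (B : Fin n → Matrix (Fin 2) (Fin 2) ℝ)
    (hB : ∀ l, InClassC (B l)) :
    (1 / Real.sqrt 2) * opNorm (((List.ofFn B).reverse).prod)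
      ≤ evNorm ((((List.ofFn B).reverse).prod).mulVec ![1, 0]) := by
  obtain ⟨h1, h2, h3, h4⟩ := aux_prod (List.ofFn B).reverse
    (by
      intro M hM
      rw [List.mem_reverse, List.mem_ofFn] at hM
      obtain ⟨l, rfl⟩ := hM
      exact hB l)
    (by
      intro h
      have := congrArg List.length h
      simp at this
      omega)
  generalize ((List.ofFn B).reverse).prod = P at *
  rw [one_div, inv_mul_le_iff₀ (by positivity)]
  refine (aux_norm P).trans ?_
  unfold evNorm
  rw [← Real.sqrt_mul (by norm_num)]
  apply Real.sqrt_le_sqrt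
  simp [Matrix.mulVec, dotProduct, Fin.sum_univ_two]
  nlinarith
end

section
/- There exists a unique real number t* such that the family ((1+ij)^{t*})_{(i,j) ∈ ℕ≥1 × ℕ≥1} is summable with ∑_{i,j=1}^∞ (1+ij)^{t*} = 1; moreover t* satisfies −2.18 < t* < −2.17. -/
def loT : List ℕ := [0, 10000000, 2222106, 921821, 493775, 304253, 204838, 146601, 109722, 84975, 67608, 54976,
  45517, 38259, 32576, 28046, 24381, 21375, 18882, 16792, 15023, 13514, 12216, 11093, 10114,
  9256, 8501, 7833, 7238, 6708, 6232, 5804, 5417, 5067, 4749, 4460, 4195, 3953, 3731, 3526, 3338,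
  3164, 3002, 2853, 2714, 2585, 2464, 2352, 2247, 2149, 2057, 1970, 1889, 1812, 1740, 1672, 1608,
  1547, 1490, 1436, 1384, 1336, 1289, 1245, 1203, 1164, 1126, 1089, 1055, 1022, 991, 961, 932,
  904, 878, 853]

def hiT : List ℕ := [0, 10000001, 2206758, 911750, 486978, 299396, 201202, 143776, 107465, 83129, 66070, 53674,
  44401, 37291, 31728, 27298, 23715, 20779, 18345, 16305, 14580, 13109, 11845, 10751, 9799, 8964,
  8230, 7580, 7002, 6486, 6024, 5609, 5234, 4894, 4586, 4305, 4049, 3814, 3599, 3401, 3218, 3049,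
  2893, 2749, 2614, 2489, 2373, 2264, 2163, 2068, 1979, 1895, 1816, 1743, 1673, 1607, 1546, 1487,
  1432, 1379, 1330, 1283, 1238, 1196, 1155, 1117, 1080, 1046, 1012, 981, 950, 921, 894, 867, 842,
  818]

def lo (n : ℕ) : ℕ := loT.getD n 0
def hi (n : ℕ) : ℕ := hiT.getD n 0
def KT (i : ℕ) : ℕ := [52, 22, 12, 7, 4, 2, 1, 0].getD i 0

theorem lo_check : ∀ n < 76, lo n ^ 100 * n ^ 217 ≤ (10 ^ 7) ^ 100 := by decide +kernel
theorem hi_check : ∀ n < 76, 1 ≤ n → (10 ^ 7) ^ 50 ≤ hi n ^ 50 * n ^ 109 := by decide +kernel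

theorem lo_total : 10 ^ 7 < ∑ i ∈ Finset.range 8,
    ((∑ j ∈ Finset.range 8, lo (1 + (i + 1) * (j + 1))) +
      2 * ((∑ j ∈ Finset.range (KT i), lo (1 + (i + 1) * (j + 8 + 1))) +
        ((1 + (i + 1) * (8 + KT i + 1)) * lo (1 + (i + 1) * (8 + KT i + 1)) * 100) / (117 * (i + 1)))) := by
  decide +kernel

theorem hi_total : 10 ^ 7 * ∑ i ∈ Finset.range 8,
    ((∑ j ∈ Finset.range 8, hi (1 + (i + 1) * (j + 1))) +
      2 * ((∑ j ∈ Finset.range (KT i), hi (1 + (i + 1) * (j + 8 + 1))) +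
        (((1 + (i + 1) * (8 + KT i)) * hi (1 + (i + 1) * (8 + KT i)) * 100) / (118 * (i + 1)) + 1)))
      + (8 * hi 8 * 100 / 118 + 1) ^ 2 < 10 ^ 14 := by
  decide +kernel

theorem KT_bd : ∀ i < 8, (1 + (i + 1) * (8 + KT i + 1)) < 76 ∧
    (∀ j < 8, 1 + (i + 1) * (j + 1) < 76) ∧ (∀ j < KT i, 1 + (i + 1) * (j + 8 + 1) < 76) := by
  decide +kernel

theorem lo_le (n : ℕ) (h1 : 1 ≤ n) (h : n < 76) : (lo n : ℝ) / 10 ^ 7 ≤ (n : ℝ) ^ (-2.17 : ℝ) := by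
  have hn : (0 : ℝ) < n := by exact_mod_cast h1
  have h2 : ((lo n : ℝ)) ^ 100 * (n : ℝ) ^ 217 ≤ (10 ^ 7) ^ 100 := by exact_mod_cast lo_check n h
  rw [← pow_le_pow_iff_left₀ (by positivity) (by positivity) (n := 100) (by norm_num),
    ← Real.rpow_mul_natCast hn.le, div_pow, div_le_iff₀ (by positivity)]
  have e : (-2.17 : ℝ) * ((100 : ℕ) : ℝ) = -((217 : ℕ) : ℝ) := by norm_num
  rw [e, Real.rpow_neg hn.le, Real.rpow_natCast, inv_mul_eq_div, le_div_iff₀ (by positivity)]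
  exact h2

theorem hi_ge (n : ℕ) (h1 : 1 ≤ n) (h : n < 76) : (n : ℝ) ^ (-2.18 : ℝ) ≤ (hi n : ℝ) / 10 ^ 7 := by
  have hn : (0 : ℝ) < n := by exact_mod_cast h1
  have h2 : (10 ^ 7) ^ 50 ≤ ((hi n : ℝ)) ^ 50 * (n : ℝ) ^ 109 := by exact_mod_cast hi_check n h h1
  rw [← pow_le_pow_iff_left₀ (by positivity) (by positivity) (n := 50) (by norm_num),
    ← Real.rpow_mul_natCast hn.le, div_pow, le_div_iff₀ (by positivity)]
  have e : (-2.18 : ℝ) * ((50 : ℕ) : ℝ) = -((109 : ℕ) : ℝ) := by norm_num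
  rw [e, Real.rpow_neg hn.le, Real.rpow_natCast, inv_mul_eq_div, div_le_iff₀ (by positivity)]
  exact h2

theorem tangent {a b p : ℝ} (ha : 0 < a) (hb : 0 < b) (hp : 0 < p) :
    a ^ (-p) - p * a ^ (-(1 + p)) * (b - a) ≤ b ^ (-p) := by
  have h1 : 1 - p * (b / a - 1) ≤ (b / a) ^ (-p) := by
    rw [Real.rpow_def_of_pos (by positivity)]
    have h2 := Real.add_one_le_exp (Real.log (b / a) * -p)
    have h3 := Real.log_le_sub_one_of_pos (show 0 < b / a by positivity)
    nlinarith
  rw [Real.div_rpow hb.le ha.le, le_div_iff₀ (by positivity)] at h1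
  have h4 : a ^ (-(1 + p)) = a ^ (-p) / a := by
    rw [show -(1 + p) = -p - 1 by ring, Real.rpow_sub_one ha.ne']
  rw [h4]
  calc _ = (1 - p * (b / a - 1)) * a ^ (-p) := by field_simp
    _ ≤ _ := h1

theorem tele {c d p : ℝ} (hc : 0 < c) (hd : 0 < d) (hp : 0 < p) :
    HasSum (fun j : ℕ => ((c + d * j) ^ (-p) - (c + d * (j + 1)) ^ (-p)) / (p * d))
      (c ^ (-p) / (p * d)) := by
  rw [hasSum_iff_tendsto_nat_of_nonneg]
  · have h : ∀ n : ℕ, ∑ j ∈ Finset.range n,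
        ((c + d * j) ^ (-p) - (c + d * (j + 1)) ^ (-p)) / (p * d)
        = (c ^ (-p) - (c + d * n) ^ (-p)) / (p * d) := by
      intro n
      rw [← Finset.sum_div]
      have := Finset.sum_range_sub' (fun j : ℕ => (c + d * j) ^ (-p)) n
      simp only [Nat.cast_add, Nat.cast_one, Nat.cast_zero, mul_zero, add_zero] at this
      rw [this]
    simp_rw [h]
    have h2 : Filter.Tendsto (fun n : ℕ => (c + d * (n : ℝ)) ^ (-p)) Filter.atTop (nhds 0) := by
      apply (tendsto_rpow_neg_atTop hp).comp
      apply Filter.tendsto_atTop_add_const_left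
      exact tendsto_natCast_atTop_atTop.const_mul_atTop hd
    simpa using (h2.const_sub (c ^ (-p))).div_const (p * d)
  · intro j
    apply div_nonneg _ (by positivity)
    rw [sub_nonneg]
    apply Real.rpow_le_rpow_of_nonpos (by positivity) (by nlinarith) (by linarith)

theorem tail_hi {c d p : ℝ} (hc : 0 < c) (hd : 0 < d) (hp : 0 < p) :
    Summable (fun j : ℕ => (c + d * (j + 1)) ^ (-(1 + p))) ∧
    ∑' j : ℕ, (c + d * (j + 1)) ^ (-(1 + p)) ≤ c ^ (-p) / (p * d) := by
  have ht := tele hc hd hp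
  have hle : ∀ j : ℕ, (c + d * (j + 1)) ^ (-(1 + p)) ≤
      ((c + d * j) ^ (-p) - (c + d * (j + 1)) ^ (-p)) / (p * d) := by
    intro j
    rw [le_div_iff₀ (by positivity)]
    have := tangent (a := c + d * (j + 1)) (b := c + d * j) (by positivity) (by positivity) hp
    linarith
  have hs := Summable.of_nonneg_of_le (fun j => by positivity) hle ht.summable
  refine ⟨hs, ?_⟩
  rw [← ht.tsum_eq]
  exact hs.tsum_le_tsum hle ht.summable

theorem tail_lo {c d p : ℝ} (hc : 0 < c) (hd : 0 < d) (hp : 0 < p)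
    (hs : Summable (fun j : ℕ => (c + d * j) ^ (-(1 + p)))) :
    c ^ (-p) / (p * d) ≤ ∑' j : ℕ, (c + d * j) ^ (-(1 + p)) := by
  have ht := tele hc hd hp
  rw [← ht.tsum_eq]
  refine ht.summable.tsum_le_tsum ?_ hs
  intro j
  rw [div_le_iff₀ (by positivity)]
  have := tangent (a := c + d * j) (b := c + d * (j + 1)) (by positivity) (by positivity) hp
  linarith

noncomputable def F (t : ℝ) (q : ℕ × ℕ) : ℝ := (1 + ((q.1 : ℝ) + 1) * ((q.2 : ℝ) + 1)) ^ t

theorem F_nonneg (t : ℝ) (q : ℕ × ℕ) : 0 ≤ F t q := by unfold F; positivity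

theorem F_symm (t : ℝ) (i j : ℕ) : F t (i, j) = F t (j, i) := by
  unfold F; simp only; rw [mul_comm]

theorem F_le (t : ℝ) (ht : t ≤ 0) (q : ℕ × ℕ) :
    F t q ≤ ((q.1 : ℝ) + 1) ^ t * ((q.2 : ℝ) + 1) ^ t := by
  unfold F
  rw [← Real.mul_rpow (by positivity) (by positivity)]
  exact Real.rpow_le_rpow_of_nonpos (by positivity) (by linarith) ht

theorem summable_one (t : ℝ) (ht : t < -1) : Summable (fun n : ℕ => ((n : ℝ) + 1) ^ t) := by
  have := (summable_nat_add_iff 1).2 (Real.summable_nat_rpow.2 ht)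
  simpa using this

theorem F_summable (t : ℝ) (ht : t < -1) : Summable (F t) := by
  have h := (summable_one t ht).mul_of_nonneg (summable_one t ht)
    (fun n => by positivity) (fun n => by positivity)
  exact Summable.of_nonneg_of_le (F_nonneg t) (F_le t (by linarith)) h

theorem decomp (t : ℝ) (ht : t < -1) :
    ∑' q, F t q = (∑ i ∈ Finset.range 8,
      ((∑ j ∈ Finset.range 8, F t (i, j)) + 2 * ((∑ j ∈ Finset.range (KT i), F t (i, j + 8)) +
        ∑' j : ℕ, F t (i, j + KT i + 8)))) + ∑' i : ℕ, ∑' j : ℕ, F t (i + 8, j + 8) := by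
  have hs := F_summable t ht
  have hrow : ∀ i, Summable (fun j => F t (i, j)) := fun i => hs.prod_factor i
  have hrow8 : ∀ i, Summable (fun j => F t (i, j + 8)) :=
    fun i => (summable_nat_add_iff 8).2 (hrow i)
  have hcol8 : ∀ j, Summable (fun i => F t (i + 8, j)) := by
    intro j
    simp_rw [F_symm t _ j]
    exact hrow8 j
  have hR : Summable (fun i => ∑' j, F t (i, j)) := hs.prod
  have e1 : ∀ i, ∑' j, F t (i, j) = ∑ j ∈ Finset.range 8, F t (i, j) + ∑' j, F t (i, j + 8) :=
    fun i => ((hrow i).sum_add_tsum_nat_add 8).symm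
  have e2 : ∀ i, ∑' j, F t (i, j + 8) = ∑ j ∈ Finset.range (KT i), F t (i, j + 8) +
      ∑' j, F t (i, j + KT i + 8) := fun i => ((hrow8 i).sum_add_tsum_nat_add (KT i)).symm
  have hS8 : Summable (fun i => ∑ j ∈ Finset.range 8, F t (i + 8, j)) :=
    summable_sum (fun j _ => hcol8 j)
  have hR8 : Summable (fun i => ∑' j, F t (i + 8, j)) := (summable_nat_add_iff 8).2 hR
  have hQ : Summable (fun i => ∑' j, F t (i + 8, j + 8)) := by
    have := hR8.sub hS8
    refine this.congr ?_
    intro i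
    rw [e1 (i + 8)]; ring
  rw [hs.tsum_prod, ← hR.sum_add_tsum_nat_add 8]
  have e3 : ∑' i, ∑' j, F t (i + 8, j) = ∑ j ∈ Finset.range 8, ∑' i, F t (j, i + 8)
      + ∑' i, ∑' j, F t (i + 8, j + 8) := by
    simp_rw [fun i => e1 (i + 8)]
    rw [hS8.tsum_add hQ, Summable.tsum_finsetSum (fun j _ => hcol8 j)]
    congr 1
    apply Finset.sum_congr rfl
    intro j _
    exact tsum_congr fun i => F_symm t _ _
  rw [e3, ← add_assoc, ← Finset.sum_add_distrib]
  congr 1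
  apply Finset.sum_congr rfl
  intro i _
  rw [← e2, e1]; ring

theorem F_nat (t : ℝ) (i j : ℕ) : F t (i, j) = (((1 + (i + 1) * (j + 1) : ℕ)) : ℝ) ^ t := by
  unfold F; push_cast; rfl

theorem lower : 1 < ∑' q, F (-2.17) q := by
  rw [decomp _ (by norm_num)]
  have hs := F_summable (-2.17) (by norm_num)
  have hQ : 0 ≤ ∑' i : ℕ, ∑' j : ℕ, F (-2.17) (i + 8, j + 8) :=
    tsum_nonneg fun i => tsum_nonneg fun j => F_nonneg _ _
  have ht : ∀ i < 8, (((1 + (i + 1) * (8 + KT i + 1)) * lo (1 + (i + 1) * (8 + KT i + 1)) * 100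
      / (117 * (i + 1)) : ℕ) : ℝ) / 10 ^ 7 ≤ ∑' j : ℕ, F (-2.17) (i, j + KT i + 8) := by
    intro i hi
    have hb := (KT_bd i hi).1
    have hrow : Summable (fun j => F (-2.17) (i, j + KT i + 8)) :=
      (summable_nat_add_iff (KT i)).2 ((summable_nat_add_iff 8).2 (hs.prod_factor i))
    have e : ∀ j : ℕ, F (-2.17) (i, j + KT i + 8) =
        (((1 + (i + 1) * (8 + KT i + 1) : ℕ) : ℝ) + ((i : ℝ) + 1) * j) ^ (-(1 + 1.17) : ℝ) := by
      intro j
      unfold F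
      push_cast
      congr 1
      · ring
      · norm_num
    simp_rw [e] at hrow ⊢
    set m : ℕ := 1 + (i + 1) * (8 + KT i + 1) with hm
    have hm0 : (0 : ℝ) < m := by positivity
    refine le_trans ?_ (tail_lo hm0 (by positivity) (by norm_num) hrow)
    have h1 : (m : ℝ) ^ (-1.17 : ℝ) = m * (m : ℝ) ^ (-2.17 : ℝ) := by
      rw [show (-1.17 : ℝ) = 1 + -2.17 by norm_num, Real.rpow_add hm0, Real.rpow_one]
    rw [h1]
    have h2 := lo_le m (by omega) hb
    calc _ ≤ (((m * lo m * 100 : ℕ) : ℝ) / ((117 * (i + 1) : ℕ) : ℝ)) / 10 ^ 7 := by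
          gcongr; exact Nat.cast_div_le
      _ = m * (lo m / 10 ^ 7) / (1.17 * (i + 1)) := by
          push_cast; field_simp; ring
      _ ≤ _ := by gcongr
  have h := lo_total
  have h' := (Nat.cast_lt (α := ℝ)).2 h
  rw [Nat.cast_sum] at h'
  refine lt_of_lt_of_le ?_ (le_add_of_nonneg_right hQ)
  have e7 : ((10 ^ 7 : ℕ) : ℝ) = 10 ^ 7 := by norm_num
  rw [e7, ← one_mul ((10 : ℝ) ^ 7), ← lt_div_iff₀ (by norm_num)] at h'
  refine lt_of_lt_of_le h' ?_
  rw [Finset.sum_div]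
  apply Finset.sum_le_sum
  intro i hi
  have hi := Finset.mem_range.1 hi
  obtain ⟨-, hb1, hb2⟩ := KT_bd i hi
  have a1 : ((∑ j ∈ Finset.range 8, lo (1 + (i + 1) * (j + 1)) : ℕ) : ℝ) / 10 ^ 7 ≤
      ∑ j ∈ Finset.range 8, F (-2.17) (i, j) := by
    rw [Nat.cast_sum, Finset.sum_div]
    apply Finset.sum_le_sum
    intro j hj
    rw [F_nat]
    exact lo_le _ (by omega) (hb1 j (Finset.mem_range.1 hj))
  have a2 : ((∑ j ∈ Finset.range (KT i), lo (1 + (i + 1) * (j + 8 + 1)) : ℕ) : ℝ) / 10 ^ 7 ≤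
      ∑ j ∈ Finset.range (KT i), F (-2.17) (i, j + 8) := by
    rw [Nat.cast_sum, Finset.sum_div]
    apply Finset.sum_le_sum
    intro j hj
    rw [F_nat]
    exact lo_le _ (by omega) (hb2 j (Finset.mem_range.1 hj))
  have a3 := ht i hi
  rw [Nat.cast_add, Nat.cast_mul, Nat.cast_add, Nat.cast_ofNat]
  rw [add_div, mul_div_assoc, add_div]
  linarith

theorem upper : ∑' q, F (-2.18) q < 1 := by
  rw [decomp _ (by norm_num)]
  have hs := F_summable (-2.18) (by norm_num)
  have pw : ∀ m : ℕ, 1 ≤ m → (m : ℝ) ^ (-1.18 : ℝ) = m * (m : ℝ) ^ (-2.18 : ℝ) := by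
    intro m h
    have hm0 : (0 : ℝ) < m := by exact_mod_cast h
    rw [show (-1.18 : ℝ) = 1 + -2.18 by norm_num, Real.rpow_add hm0, Real.rpow_one]
  have dv : ∀ a b : ℕ, 0 < b → (a : ℝ) / b ≤ ((a / b + 1 : ℕ) : ℝ) := by
    intro a b hb
    have hb' : (0 : ℝ) < b := by exact_mod_cast hb
    rw [div_le_iff₀ hb']
    exact_mod_cast (Nat.lt_div_mul_add hb |>.le.trans (by ring_nf; rfl))
  have hQ : ∑' i : ℕ, ∑' j : ℕ, F (-2.18) (i + 8, j + 8) ≤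
      (((8 * hi 8 * 100 / 118 + 1 : ℕ) : ℝ) / 10 ^ 7) ^ 2 := by
    obtain ⟨hz, hz'⟩ := tail_hi (c := (8 : ℕ)) (d := 1) (p := 1.18) (by norm_num) (by norm_num)
      (by norm_num)
    have ez : ∀ j : ℕ, (((8 : ℕ) : ℝ) + 1 * (j + 1)) ^ (-(1 + 1.18) : ℝ) =
        (((j + 8 : ℕ) : ℝ) + 1) ^ (-2.18 : ℝ) := by
      intro j
      congr 1
      · push_cast; ring
      · norm_num
    simp_rw [ez] at hz hz'
    rw [pw 8 (by norm_num)] at hz'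
    set Z := ∑' j : ℕ, (((j + 8 : ℕ) : ℝ) + 1) ^ (-2.18 : ℝ) with hZ
    have hZ0 : 0 ≤ Z := tsum_nonneg fun j => by positivity
    have hrow : ∀ i, Summable (fun j => F (-2.18) (i + 8, j + 8)) :=
      fun i => (summable_nat_add_iff 8).2 (hs.prod_factor (i + 8))
    have hin : ∀ i : ℕ, ∑' j : ℕ, F (-2.18) (i + 8, j + 8) ≤
        (((i + 8 : ℕ) : ℝ) + 1) ^ (-2.18 : ℝ) * Z := by
      intro i
      rw [hZ, ← tsum_mul_left]
      exact (hrow i).tsum_le_tsum (fun j => F_le _ (by norm_num) _) (hz.mul_left _)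
    have hsum := Summable.of_nonneg_of_le (fun i => tsum_nonneg fun j => F_nonneg _ _) hin
      (hz.mul_right Z)
    have h1 := hsum.tsum_le_tsum hin (hz.mul_right Z)
    rw [tsum_mul_right, ← hZ] at h1
    have h2 := hi_ge 8 (by norm_num) (by norm_num)
    have h3 : Z ≤ ((8 * hi 8 * 100 / 118 + 1 : ℕ) : ℝ) / 10 ^ 7 := by
      refine hz'.trans ?_
      have h4 := dv (8 * hi 8 * 100) 118 (by norm_num)
      calc _ ≤ ((8 : ℕ) : ℝ) * ((hi 8 : ℝ) / 10 ^ 7) / (1.18 * 1) := by gcongr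
        _ = (((8 * hi 8 * 100 : ℕ) : ℝ) / ((118 : ℕ) : ℝ)) / 10 ^ 7 := by
          push_cast; ring
        _ ≤ _ := by gcongr
    calc _ ≤ Z * Z := h1
      _ = Z ^ 2 := by ring
      _ ≤ _ := by gcongr
  have ht : ∀ i < 8, ∑' j : ℕ, F (-2.18) (i, j + KT i + 8) ≤
      (((1 + (i + 1) * (8 + KT i)) * hi (1 + (i + 1) * (8 + KT i)) * 100
      / (118 * (i + 1)) + 1 : ℕ) : ℝ) / 10 ^ 7 := by
    intro i hi8
    have hb := (KT_bd i hi8).1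
    have e : ∀ j : ℕ, F (-2.18) (i, j + KT i + 8) =
        (((1 + (i + 1) * (8 + KT i) : ℕ) : ℝ) + ((i : ℝ) + 1) * (j + 1)) ^ (-(1 + 1.18) : ℝ) := by
      intro j
      unfold F
      push_cast
      congr 1
      · ring
      · norm_num
    simp_rw [e]
    have hmb : 1 + (i + 1) * (8 + KT i) < 76 := by
      refine lt_of_le_of_lt ?_ hb
      exact Nat.add_le_add_left (Nat.mul_le_mul_left _ (Nat.le_succ _)) _
    set m : ℕ := 1 + (i + 1) * (8 + KT i) with hm
    have hm1 : 1 ≤ m := by omega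
    have hm0 : (0 : ℝ) < m := by exact_mod_cast hm1
    refine (tail_hi hm0 (by positivity) (by norm_num)).2.trans ?_
    rw [pw m hm1]
    have h2 := hi_ge m hm1 hmb
    have h4 := dv (m * hi m * 100) (118 * (i + 1)) (by positivity)
    calc _ ≤ m * ((hi m : ℝ) / 10 ^ 7) / (1.18 * (i + 1)) := by gcongr
      _ = (((m * hi m * 100 : ℕ) : ℝ) / ((118 * (i + 1) : ℕ) : ℝ)) / 10 ^ 7 := by
          push_cast; field_simp; ring
      _ ≤ _ := by gcongr
  have h := hi_total
  have h' := (Nat.cast_lt (α := ℝ)).2 h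
  rw [Nat.cast_add, Nat.cast_mul, Nat.cast_sum, Nat.cast_pow (8 * hi 8 * 100 / 118 + 1)] at h'
  have hmain : ∀ i ∈ Finset.range 8, ((∑ j ∈ Finset.range 8, F (-2.18) (i, j)) +
      2 * ((∑ j ∈ Finset.range (KT i), F (-2.18) (i, j + 8)) +
        ∑' j : ℕ, F (-2.18) (i, j + KT i + 8))) ≤
      (((∑ j ∈ Finset.range 8, hi (1 + (i + 1) * (j + 1))) +
      2 * ((∑ j ∈ Finset.range (KT i), hi (1 + (i + 1) * (j + 8 + 1))) +
        (((1 + (i + 1) * (8 + KT i)) * hi (1 + (i + 1) * (8 + KT i)) * 100) / (118 * (i + 1)) + 1))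
        : ℕ) : ℝ) / 10 ^ 7 := by
    intro i hi8
    have hi8 := Finset.mem_range.1 hi8
    obtain ⟨-, hb1, hb2⟩ := KT_bd i hi8
    have a1 : ∑ j ∈ Finset.range 8, F (-2.18) (i, j) ≤
        ((∑ j ∈ Finset.range 8, hi (1 + (i + 1) * (j + 1)) : ℕ) : ℝ) / 10 ^ 7 := by
      rw [Nat.cast_sum, Finset.sum_div]
      apply Finset.sum_le_sum
      intro j hj
      rw [F_nat]
      exact hi_ge _ (by omega) (hb1 j (Finset.mem_range.1 hj))
    have a2 : ∑ j ∈ Finset.range (KT i), F (-2.18) (i, j + 8) ≤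
        ((∑ j ∈ Finset.range (KT i), hi (1 + (i + 1) * (j + 8 + 1)) : ℕ) : ℝ) / 10 ^ 7 := by
      rw [Nat.cast_sum, Finset.sum_div]
      apply Finset.sum_le_sum
      intro j hj
      rw [F_nat]
      exact hi_ge _ (by omega) (hb2 j (Finset.mem_range.1 hj))
    have a3 := ht i hi8
    rw [Nat.cast_add (∑ j ∈ Finset.range 8, hi (1 + (i + 1) * (j + 1))), Nat.cast_mul 2,
      Nat.cast_add (∑ j ∈ Finset.range (KT i), hi (1 + (i + 1) * (j + 8 + 1))), Nat.cast_ofNat]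
    rw [add_div, mul_div_assoc, add_div]
    linarith
  have hsum := Finset.sum_le_sum hmain
  rw [← Finset.sum_div] at hsum
  refine lt_of_le_of_lt (add_le_add hsum hQ) ?_
  rw [div_pow, div_add_div _ _ (by norm_num) (by norm_num), div_lt_one (by norm_num)]
  have e7 : ((10 ^ 7 : ℕ) : ℝ) = 10 ^ 7 := by norm_num
  have e14 : ((10 ^ 14 : ℕ) : ℝ) = 10 ^ 14 := by norm_num
  rw [e7, e14] at h'
  nlinarith [h']

theorem pn (t : ℝ) : (fun q : ℕ+ × ℕ+ => (1 + (q.1 : ℝ) * (q.2 : ℝ)) ^ t) =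
    F t ∘ (Equiv.prodCongr Equiv.pnatEquivNat Equiv.pnatEquivNat) := by
  funext q
  have e : ∀ n : ℕ+, ((n.natPred : ℝ)) + 1 = (n : ℝ) := by
    intro n
    exact_mod_cast n.natPred_add_one
  simp [F, e]

theorem F_mono {t u : ℝ} (h : t ≤ u) (q : ℕ × ℕ) : F t q ≤ F u q := by
  unfold F
  exact Real.rpow_le_rpow_of_exponent_le (by nlinarith [show (0 : ℝ) ≤ ((q.1 : ℝ) + 1) * ((q.2 : ℝ) + 1) by positivity]) h

theorem S_strict {t u : ℝ} (h : t < u) (ht : Summable (F t)) (hu : Summable (F u)) :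
    ∑' q, F t q < ∑' q, F u q := by
  refine Summable.tsum_lt_tsum (i := (0, 0)) (F_mono h.le) ?_ ht hu
  unfold F
  exact Real.rpow_lt_rpow_of_exponent_lt (by norm_num) h

theorem S_cont : ContinuousOn (fun t => ∑' q, F t q) (Set.Icc (-2.18) (-2.17)) := by
  apply continuousOn_tsum (u := F (-2.17)) _ (F_summable _ (by norm_num))
  · intro q t ht
    rw [Real.norm_of_nonneg (F_nonneg _ _)]
    exact F_mono ht.2 q
  · intro q
    unfold F
    apply Continuous.continuousOn
    exact Real.continuous_const_rpow (by positivity)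



/-- There is a unique real `t*` such that the family
`((1 + i j) ^ t*)_{i,j ≥ 1}` is summable with sum `1`; moreover `-2.18 < t* < -2.17`. -/
theorem stmt11 :
    ∃ tstar : ℝ,
      (-2.18 < tstar ∧ tstar < -2.17) ∧
      (Summable (fun q : ℕ+ × ℕ+ => (1 + (q.1 : ℝ) * (q.2 : ℝ)) ^ tstar) ∧
        ∑' q : ℕ+ × ℕ+, (1 + (q.1 : ℝ) * (q.2 : ℝ)) ^ tstar = 1) ∧
      ∀ t : ℝ,
        (Summable (fun q : ℕ+ × ℕ+ => (1 + (q.1 : ℝ) * (q.2 : ℝ)) ^ t) ∧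
          ∑' q : ℕ+ × ℕ+, (1 + (q.1 : ℝ) * (q.2 : ℝ)) ^ t = 1) → t = tstar := by
  have key : ∀ t : ℝ, (Summable (fun q : ℕ+ × ℕ+ => (1 + (q.1 : ℝ) * (q.2 : ℝ)) ^ t) ∧
          ∑' q : ℕ+ × ℕ+, (1 + (q.1 : ℝ) * (q.2 : ℝ)) ^ t = 1) ↔
          (Summable (F t) ∧ ∑' q, F t q = 1) := by
    intro t
    rw [pn t, Equiv.summable_iff]
    have := (Equiv.prodCongr Equiv.pnatEquivNat Equiv.pnatEquivNat).tsum_eq (F t)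
    rw [← this]
    rfl
  simp_rw [key]
  obtain ⟨t, ht, h1⟩ := intermediate_value_Ioo (by norm_num) S_cont
    (show (1 : ℝ) ∈ Set.Ioo _ _ from ⟨upper, lower⟩)
  have hs := F_summable t (by linarith [ht.2])
  refine ⟨t, ht, ⟨hs, h1⟩, ?_⟩
  rintro u ⟨hu, hu1⟩
  simp only at h1
  rcases lt_trichotomy u t with h | h | h
  · have := S_strict h hu hs
    linarith
  · exact h
  · have := S_strict h hs hu
    linarith
end

section
/- Let t* be the unique real number with ∑_{i,j=1}^∞ (1+ij)^{t*} = 1 (so −2.18 < t* < −2.17). Then for every real t < t*, P(t) = 0, where P(t) := lim_{n→∞} (1/n) log ∑_{I ∈ {1,2}^n} ‖A_{i_{n−1}} ⋯ A_{i_0}‖^t. -/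
open Filter

/-- For a word `I = (i₀, …, i_{n-1}) ∈ {1,2}ⁿ` (symbol `1` encoded as `0 : Fin 2`,
symbol `2` as `1 : Fin 2`), the matrix `𝒜_I = A_{i_{n-1}} ⋯ A_{i₁} A_{i₀}`. -/
def wordProd (n : ℕ) (I : Fin n → Fin 2) : Matrix (Fin 2) (Fin 2) ℝ :=
  ((List.ofFn fun l : Fin n => if I l = 0 then A1 else A2).reverse).prod

/-- `s_n(t) = ∑_{I ∈ {1,2}ⁿ} ‖𝒜_I‖^t`. -/
noncomputable def sFun (n : ℕ) (t : ℝ) : ℝ :=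
  ∑ I : Fin n → Fin 2, opNorm (wordProd n I) ^ t


noncomputable def FF (t : ℝ) : ℕ → ℝ → ℝ → ℝ
  | 0, _, b => b ^ t
  | n + 1, a, b => FF t n a (a + b) + FF t n (a + b) b

noncomputable def vv (t : ℝ) : ℕ → ℝ
  | 0 => 1
  | n + 1 => FF t n 1 1

lemma FF_mono (t : ℝ) (ht : t < 0) (n : ℕ) : ∀ a b a' b' c : ℝ, 0 ≤ a → 0 < b → 0 < c →
    c * a ≤ a' → c * b ≤ b' → FF t n a' b' ≤ c ^ t * FF t n a b := by
  induction n with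
  | zero =>
    intro a b a' b' c ha hb hc h1 h2
    simp only [FF]
    rw [← Real.mul_rpow hc.le hb.le]
    exact Real.rpow_le_rpow_of_nonpos (by positivity) h2 ht.le
  | succ n ih =>
    intro a b a' b' c ha hb hc h1 h2
    simp only [FF]
    rw [mul_add]
    exact add_le_add (ih _ _ _ _ _ ha (by linarith) hc h1 (by linarith))
      (ih _ _ _ _ _ (by linarith) hb hc (by linarith) h2)

lemma FF_B (t : ℝ) (ht : t < 0) (C : ℝ) (n : ℕ) : (∀ m ≤ n, vv t m ≤ C) → ∀ i j : ℕ,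
    FF t n i (1 + i * j) ≤ C * ∑ k ∈ Finset.range (n + 1), (1 + (i : ℝ) * ((j + k : ℕ) : ℝ)) ^ t := by
  induction n with
  | zero =>
    intro h i j
    have := h 0 le_rfl
    simp only [vv] at this
    simp only [FF, zero_add, Finset.sum_range_one, add_zero]
    have : (0:ℝ) ≤ (1 + (i : ℝ) * j) ^ t := by positivity
    nlinarith
  | succ n ih =>
    intro h i j
    simp only [FF]
    have h1 := ih (fun m hm => h m (by omega)) i (j + 1)
    have h2 : FF t n (i + (1 + i * j)) (1 + i * j) ≤ (1 + (i : ℝ) * j) ^ t * FF t n 1 1 := by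
      apply FF_mono t ht n <;> first | positivity | skip
      · have : (0 : ℝ) ≤ i := by positivity
        linarith
      · linarith
    have h3 : FF t n 1 1 ≤ C := h (n + 1) le_rfl
    have h4 : (0:ℝ) ≤ (1 + (i : ℝ) * j) ^ t := by positivity
    rw [Finset.sum_range_succ', mul_add]
    have e : (i : ℝ) + (1 + i * j) = 1 + i * ((j + 1 : ℕ) : ℝ) := by push_cast; ring
    apply add_le_add
    · rw [e]
      refine h1.trans (le_of_eq ?_)
      congr 1
      apply Finset.sum_congr rfl
      intro k _
      rw [show j + 1 + k = j + (k + 1) by ring]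
    · refine h2.trans ?_
      rw [add_zero]
      nlinarith

lemma FF_A (t : ℝ) (ht : t < 0) (C : ℝ) (hC : 0 ≤ C) (N : ℕ) (n : ℕ) (hn : n ≤ N) :
    (∀ m < n, vv t m ≤ C) → ∀ i : ℕ,
    FF t n i 1 ≤ 1 + C * ∑ l ∈ Finset.range n, ∑ k ∈ Finset.range N,
      (1 + ((i + l : ℕ) : ℝ) * ((1 + k : ℕ) : ℝ)) ^ t := by
  induction n with
  | zero =>
    intro h i
    simp [FF]
  | succ n ih =>
    intro h i
    simp only [FF]
    have h1 := ih (by omega) (fun m hm => h m (by omega)) (i + 1)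
    have h2 := FF_B t ht C n (fun m hm => h m (by omega)) i 1
    have h3 : ∑ k ∈ Finset.range (n + 1), (1 + (i : ℝ) * ((1 + k : ℕ) : ℝ)) ^ t ≤
        ∑ k ∈ Finset.range N, (1 + (i : ℝ) * ((1 + k : ℕ) : ℝ)) ^ t :=
      Finset.sum_le_sum_of_subset_of_nonneg (by intro x; simp; omega)
        (fun _ _ _ => by positivity)
    have h4 := h2.trans (mul_le_mul_of_nonneg_left h3 hC)
    rw [Finset.sum_range_succ', mul_add, ← add_assoc, add_comm (FF t n i _)]
    apply add_le_add
    · refine le_trans (le_of_eq ?_) (h1.trans (le_of_eq ?_))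
      · push_cast; rfl
      · congr 2
        apply Finset.sum_congr rfl
        intro l _
        rw [show i + 1 + l = i + (l + 1) by ring]
    · refine le_trans (le_of_eq ?_) h4
      congr 1
      push_cast; ring

lemma double_le (t ρ : ℝ)
    (hs : Summable (fun q : ℕ+ × ℕ+ => (1 + (q.1 : ℝ) * (q.2 : ℝ)) ^ t))
    (hρ : ∑' q : ℕ+ × ℕ+, (1 + (q.1 : ℝ) * (q.2 : ℝ)) ^ t = ρ) (n N : ℕ) :
    ∑ l ∈ Finset.range n, ∑ k ∈ Finset.range N,
      (1 + ((1 + l : ℕ) : ℝ) * ((1 + k : ℕ) : ℝ)) ^ t ≤ ρ := by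
  rw [← Finset.sum_product', ← hρ]
  let e : ℕ × ℕ ↪ ℕ+ × ℕ+ := ⟨fun p => (p.1.succPNat, p.2.succPNat), by
    rintro ⟨a, b⟩ ⟨c, d⟩ h
    simpa using h⟩
  have := hs.sum_le_tsum ((Finset.range n ×ˢ Finset.range N).map e)
    (fun _ _ => by positivity)
  refine le_trans (le_of_eq ?_) this
  rw [Finset.sum_map]
  apply Finset.sum_congr rfl
  rintro ⟨a, b⟩ _
  change _ = (1 + ((a.succPNat : ℕ) : ℝ) * ((b.succPNat : ℕ) : ℝ)) ^ t
  simp [add_comm]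

lemma vv_le (t ρ : ℝ) (ht : t < 0) (h0 : 0 ≤ ρ) (h1 : ρ < 1)
    (hs : Summable (fun q : ℕ+ × ℕ+ => (1 + (q.1 : ℝ) * (q.2 : ℝ)) ^ t))
    (hρ : ∑' q : ℕ+ × ℕ+, (1 + (q.1 : ℝ) * (q.2 : ℝ)) ^ t = ρ) (n : ℕ) :
    vv t n ≤ 1 / (1 - ρ) := by
  have hp : 0 < 1 - ρ := by linarith
  have hC : 0 ≤ 1 / (1 - ρ) := by positivity
  have e : 1 + 1 / (1 - ρ) * ρ = 1 / (1 - ρ) := by field_simp; ring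
  induction n using Nat.strong_induction_on with
  | _ n ih =>
    cases n with
    | zero =>
      simp only [vv]
      rw [le_div_iff₀ hp]; linarith
    | succ n =>
      simp only [vv]
      have h2 := FF_A t ht _ hC n n le_rfl (fun m hm => ih m (by omega)) 1
      have h3 := mul_le_mul_of_nonneg_left (double_le t ρ hs hρ n n) hC
      rw [Nat.cast_one] at h2
      linarith

lemma FF_u (t C : ℝ) (hv : ∀ n, vv t n ≤ C) (n : ℕ) : FF t n 0 1 ≤ C * (n + 1) := by
  induction n with
  | zero =>
    have := hv 0
    simpa [FF, vv] using this
  | succ n ih =>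
    have := hv (n + 1)
    simp only [vv] at this
    simp only [FF, zero_add]
    push_cast
    linarith

lemma wordProd_cons (n : ℕ) (x : Fin 2) (I : Fin n → Fin 2) :
    wordProd (n + 1) (Fin.cons x I) = wordProd n I * (if x = 0 then A1 else A2) := by
  simp [wordProd, List.ofFn_succ]

lemma A1_mulVec (a b : ℝ) : A1.mulVec ![a, b] = ![a, a + b] := by
  ext i; fin_cases i <;> simp [A1, Matrix.mulVec, dotProduct, Fin.sum_univ_two]

lemma A2_mulVec (a b : ℝ) : A2.mulVec ![a, b] = ![a + b, b] := by
  ext i; fin_cases i <;> simp [A2, Matrix.mulVec, dotProduct, Fin.sum_univ_two]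

lemma sum_FF (t : ℝ) (n : ℕ) : ∀ a b : ℝ,
    ∑ I : Fin n → Fin 2, ((wordProd n I).mulVec ![a, b] 1) ^ t = FF t n a b := by
  induction n with
  | zero => intro a b; simp [FF, wordProd]
  | succ n ih =>
    intro a b
    rw [← (Fin.consEquiv (fun _ => Fin 2)).sum_comp, Fintype.sum_prod_type, Fin.sum_univ_two]
    have hc : ∀ (x : Fin 2) (I : Fin n → Fin 2), wordProd (n + 1)
        ((Fin.consEquiv (fun _ => Fin 2)) (x, I)) = wordProd n I * (if x = 0 then A1 else A2) :=
      wordProd_cons n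
    simp only [hc, ← Matrix.mulVec_mulVec, if_true,
      one_ne_zero, if_false, A1_mulVec, A2_mulVec, FF, ih]

lemma word_pos (n : ℕ) : ∀ (I : Fin n → Fin 2) (a b : ℝ), 0 ≤ a → 0 < b →
    0 < (wordProd n I).mulVec ![a, b] 1 := by
  induction n with
  | zero => intro I a b ha hb; simpa [wordProd] using hb
  | succ n ih =>
    intro I a b ha hb
    rw [← Fin.cons_self_tail I, wordProd_cons, ← Matrix.mulVec_mulVec]
    split_ifs
    · rw [A1_mulVec]; exact ih _ _ _ ha (by linarith)
    · rw [A2_mulVec]; exact ih _ _ _ (by linarith) hb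

lemma entry_le (M : Matrix (Fin 2) (Fin 2) ℝ) : M.mulVec ![0, 1] 1 ≤ opNorm M := by
  have h := (Matrix.toEuclideanCLM (𝕜 := ℝ) M).le_opNorm (WithLp.toLp 2 ![0, 1])
  have h1 : ‖(WithLp.toLp 2 ![(0:ℝ), 1] : EuclideanSpace ℝ (Fin 2))‖ = 1 := by
    simp [EuclideanSpace.norm_eq]
  rw [h1, mul_one] at h
  have h2 := PiLp.norm_apply_le (Matrix.toEuclideanCLM (𝕜 := ℝ) M (WithLp.toLp 2 ![0, 1])) 1
  refine le_trans ?_ (h2.trans h)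
  rw [Matrix.toEuclideanCLM_toLp]
  exact le_abs_self _

lemma opNorm_pos (n : ℕ) (I : Fin n → Fin 2) : 0 < opNorm (wordProd n I) :=
  (word_pos n I 0 1 le_rfl one_pos).trans_le (entry_le _)

lemma sFun_le (t : ℝ) (ht : t < 0) (n : ℕ) : sFun n t ≤ FF t n 0 1 := by
  rw [← sum_FF]
  apply Finset.sum_le_sum
  intro I _
  exact Real.rpow_le_rpow_of_nonpos (word_pos n I 0 1 le_rfl one_pos) (entry_le _) ht.le

lemma sFun_pos (t : ℝ) (n : ℕ) : 0 < sFun n t :=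
  Finset.sum_pos (fun I _ => Real.rpow_pos_of_pos (opNorm_pos n I) t) Finset.univ_nonempty

lemma word_zero (n : ℕ) : wordProd n (fun _ => 0) = 1 + (n : ℝ) • !![0, 0; 1, 0] := by
  have h : wordProd n (fun _ => 0) = A1 ^ n := by simp [wordProd]
  rw [h]
  induction n with
  | zero => simp
  | succ n ih =>
    rw [pow_succ, ih (by simp [wordProd])]
    ext i j
    fin_cases i <;> fin_cases j <;> simp [A1, Matrix.mul_apply, Fin.sum_univ_two]

lemma lower_s15 (t : ℝ) (ht : t < 0) : ∃ K : ℝ, 0 < K ∧ ∀ n : ℕ, (K * (n + 1)) ^ t ≤ sFun n t := by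
  set N := ‖Matrix.toEuclideanCLM (𝕜 := ℝ) (!![0, 0; 1, 0] : Matrix (Fin 2) (Fin 2) ℝ)‖ with hN
  have hN0 : 0 ≤ N := norm_nonneg _
  refine ⟨1 + N, by positivity, fun n => ?_⟩
  have h1 : opNorm (wordProd n (fun _ => 0)) ≤ (1 + N) * (n + 1) := by
    rw [word_zero, opNorm, map_add, map_smul, map_one]
    refine (norm_add_le _ _).trans ?_
    rw [norm_smul, norm_one, ← hN, Real.norm_natCast]
    have : (0:ℝ) ≤ n := by positivity
    nlinarith
  refine (Real.rpow_le_rpow_of_nonpos (opNorm_pos _ _) h1 ht.le).trans ?_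
  exact Finset.single_le_sum (f := fun I => opNorm (wordProd n I) ^ t)
    (fun I _ => Real.rpow_nonneg (opNorm_pos n I).le t) (Finset.mem_univ _)

lemma log_lim (K : ℝ) (hK : 0 < K) :
    Tendsto (fun n : ℕ => Real.log (K * (n + 1)) / n) atTop (nhds 0) := by
  have h1 : Tendsto (fun x : ℝ => Real.log x / (K⁻¹ * x + (-1))) atTop (nhds 0) := by
    simpa using Real.tendsto_pow_log_div_mul_add_atTop K⁻¹ (-1) 1 (by positivity)
  have h2 : Tendsto (fun n : ℕ => K * ((n : ℝ) + 1)) atTop atTop :=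
    (tendsto_atTop_add_const_right _ _ tendsto_natCast_atTop_atTop).const_mul_atTop hK
  refine (h1.comp h2).congr (fun n => ?_)
  simp only [Function.comp]
  congr 1
  field_simp
  ring

/-- Let `t*` be the unique real number with
`∑_{i,j=1}^∞ (1 + i j)^{t*} = 1`.  Then `P(t) = 0` for every `t < t*`, where
`P(t) = lim_{n→∞} (1/n) log s_n(t)`. -/
theorem stmt15 (tstar : ℝ)
    (hstar : Summable (fun q : ℕ+ × ℕ+ => (1 + (q.1 : ℝ) * (q.2 : ℝ)) ^ tstar))
    (hstar1 : ∑' q : ℕ+ × ℕ+, (1 + (q.1 : ℝ) * (q.2 : ℝ)) ^ tstar = 1)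
    (P : ℝ → ℝ)
    (hP : ∀ t : ℝ, Tendsto (fun n : ℕ => Real.log (sFun n t) / n) atTop (nhds (P t))) :
    ∀ t : ℝ, t < tstar → P t = 0 := by
  intro t ht
  have hge : ∀ q : ℕ+ × ℕ+, 1 < 1 + (q.1 : ℝ) * (q.2 : ℝ) := fun q => by
    have h1 : (0 : ℝ) < (q.1 : ℝ) := by exact_mod_cast q.1.pos
    have h2 : (0 : ℝ) < (q.2 : ℝ) := by exact_mod_cast q.2.pos
    have := mul_pos h1 h2
    linarith
  have hts : tstar < 0 := by
    by_contra! hc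
    have h1 := hstar.sum_le_tsum {((1 : ℕ+), (1 : ℕ+)), (1, 2)} (fun q _ => by positivity)
    rw [hstar1, Finset.sum_pair (by decide)] at h1
    have h2 := Real.one_le_rpow (hge (1, 1)).le hc
    have h3 := Real.one_le_rpow (hge (1, 2)).le hc
    linarith
  have ht0 : t < 0 := ht.trans hts
  have hlt : ∀ q : ℕ+ × ℕ+, (1 + (q.1 : ℝ) * (q.2 : ℝ)) ^ t < (1 + (q.1 : ℝ) * (q.2 : ℝ)) ^ tstar :=
    fun q => Real.rpow_lt_rpow_of_exponent_lt (hge q) ht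
  have hs : Summable (fun q : ℕ+ × ℕ+ => (1 + (q.1 : ℝ) * (q.2 : ℝ)) ^ t) :=
    Summable.of_nonneg_of_le (fun q => by positivity) (fun q => (hlt q).le) hstar
  have hρ1 : ∑' q : ℕ+ × ℕ+, (1 + (q.1 : ℝ) * (q.2 : ℝ)) ^ t < 1 := by
    exact (Summable.tsum_lt_tsum (fun q => (hlt q).le) (hlt (1, 1)) hs hstar).trans_eq hstar1
  have hρ0 : 0 ≤ ∑' q : ℕ+ × ℕ+, (1 + (q.1 : ℝ) * (q.2 : ℝ)) ^ t :=
    tsum_nonneg (fun q => by positivity)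
  have hv := vv_le t _ ht0 hρ0 hρ1 hs rfl
  set C := 1 / (1 - ∑' q : ℕ+ × ℕ+, (1 + (q.1 : ℝ) * (q.2 : ℝ)) ^ t)
  have hC : 0 < C := one_pos.trans_le (hv 0)
  apply le_antisymm
  · refine le_of_tendsto_of_tendsto' (hP t) (log_lim C hC) (fun n => ?_)
    gcongr
    · exact sFun_pos t n
    · exact (sFun_le t ht0 n).trans (FF_u t C hv n)
  · obtain ⟨K, hK, h⟩ := lower_s15 t ht0
    have hl := (log_lim K hK).const_mul t
    rw [mul_zero] at hl
    refine le_of_tendsto_of_tendsto' hl (hP t) (fun n => ?_)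
    have hp : 0 < K * ((n : ℝ) + 1) := by positivity
    rw [← mul_div_assoc, ← Real.log_rpow hp]
    gcongr
    exact h n
end

section
/- Let Σ = {1,2}^ℤ with the shift map T, and let 𝒜^n(x) := A_{x_{n−1}} ⋯ A_{x_1} A_{x_0} for x ∈ Σ. Let D = [2.1] = {x ∈ Σ : x_{−1} = 2 and x_0 = 1}. Then for every T-invariant ergodic Borel probability measure μ on Σ with μ(D) > 0, the limit χ(μ, 𝒜) := lim_{n→∞} (1/n) ∫ log ‖𝒜^n(x)‖ dμ(x) exists and satisfies χ(μ, 𝒜) ≥ μ(D) · log 2 > 0. -/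
open Filter MeasureTheory

/-- `Σ = {1,2}^ℤ`, with the symbol `1` encoded as `0 : Fin 2` and `2` as `1 : Fin 2`. -/
abbrev Sigma2 : Type := ℤ → Fin 2

/-- The left shift `T` on `Σ`: `(T x)_ℓ = x_{ℓ+1}`. -/
def shift (x : Sigma2) : Sigma2 := fun l => x (l + 1)

/-- The one-step cocycle: `𝒜ⁿ(x) = A_{x_{n-1}} ⋯ A_{x_1} A_{x_0}`. -/
def cocycle (n : ℕ) (x : Sigma2) : Matrix (Fin 2) (Fin 2) ℝ :=
  ((List.ofFn fun l : Fin n => if x ((l : ℕ) : ℤ) = 0 then A1 else A2).reverse).prod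

/-- The cylinder set `D = [2.1] = {x : x₋₁ = 2, x₀ = 1}`. -/
def D : Set Sigma2 := {x | x (-1) = 1 ∧ x 0 = 0}

lemma cocycle_zero' (x : Sigma2) : cocycle 0 x = 1 := by simp [cocycle]

lemma cocycle_succ' (n : ℕ) (x : Sigma2) :
    cocycle (n+1) x = (if x (n : ℤ) = 0 then A1 else A2) * cocycle n x := by
  unfold cocycle
  rw [List.ofFn_succ_last]
  simp

lemma shift_iter (n : ℕ) (x : Sigma2) (l : ℤ) : (shift^[n] x) l = x (l + n) := by
  induction n generalizing x with
  | zero => simp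
  | succ n ih =>
    rw [Function.iterate_succ_apply, ih]
    simp only [shift]
    congr 1
    push_cast
    ring

lemma cocycle_add' (m n : ℕ) (x : Sigma2) :
    cocycle (m+n) x = cocycle m (shift^[n] x) * cocycle n x := by
  induction m with
  | zero => simp [cocycle_zero']
  | succ m ih =>
    rw [show m + 1 + n = (m+n)+1 by ring, cocycle_succ', cocycle_succ', ih, shift_iter,
      Matrix.mul_assoc]
    push_cast
    rfl

lemma cont_cocycle (n : ℕ) : Continuous (cocycle n) := by
  induction n with
  | zero =>
    have : cocycle 0 = fun _ => 1 := funext cocycle_zero'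
    rw [this]; exact continuous_const
  | succ n ih =>
    have : cocycle (n+1) = fun x => (if x (n : ℤ) = 0 then A1 else A2) * cocycle n x :=
      funext (cocycle_succ' n)
    rw [this]
    refine Continuous.mul ?_ ih
    have h : Continuous (fun a : Fin 2 => if a = 0 then A1 else A2) := continuous_of_discreteTopology
    exact h.comp (continuous_apply (n : ℤ))

lemma cont_opNorm : Continuous opNorm := by
  unfold opNorm
  refine continuous_norm.comp ?_
  exact LinearMap.continuous_of_finiteDimensional
    (F' := EuclideanSpace ℝ (Fin 2) →L[ℝ] EuclideanSpace ℝ (Fin 2))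
    { toFun := fun M : Matrix (Fin 2) (Fin 2) ℝ => Matrix.toEuclideanCLM (𝕜 := ℝ) M
      map_add' := fun a b => map_add _ a b
      map_smul' := fun c a => map_smul _ c a }

lemma opNorm_mul (M N : Matrix (Fin 2) (Fin 2) ℝ) : opNorm (M * N) ≤ opNorm M * opNorm N := by
  unfold opNorm
  rw [map_mul]
  exact norm_mul_le _ _

noncomputable def SS (n : ℕ) (x : Sigma2) : ℝ :=
  ∑ j ∈ Finset.range n, D.indicator (fun _ => Real.log 2) (shift^[j] x)

lemma key (n : ℕ) (x : Sigma2) :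
    0 ≤ (cocycle n x).mulVec ![1,1] 0 ∧
    Real.exp (SS n x) ≤ (cocycle n x).mulVec ![1,1] 1 ∧
    (x ((n:ℤ) - 1) = 1 → Real.exp (SS n x) ≤ (cocycle n x).mulVec ![1,1] 0) := by
  induction n with
  | zero => simp [cocycle_zero', SS]
  | succ n ih =>
    obtain ⟨h0, h1, h2⟩ := ih
    rw [cocycle_succ', ← Matrix.mulVec_mulVec]
    set v := (cocycle n x).mulVec ![1,1] with hv
    have hS : SS (n+1) x = SS n x + D.indicator (fun _ => Real.log 2) (shift^[n] x) := by
      simp [SS, Finset.sum_range_succ]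
    have hpos := Real.exp_pos (SS n x)
    have hD : shift^[n] x ∈ D ↔ (x ((n:ℤ) - 1) = 1 ∧ x n = 0) := by
      simp only [D, Set.mem_setOf_eq, shift_iter]
      rw [show (-1 + (n:ℤ)) = n - 1 by ring, zero_add]
    push_cast
    rw [add_sub_cancel_right]
    by_cases hx : x (n:ℤ) = 0
    · rw [if_pos hx]
      have e0 : A1.mulVec v 0 = v 0 := by simp [A1, Matrix.mulVec, dotProduct]
      have e1 : A1.mulVec v 1 = v 0 + v 1 := by simp [A1, Matrix.mulVec, dotProduct]
      rw [e0, e1, hx]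
      refine ⟨h0, ?_, by simp⟩
      by_cases hy : x ((n:ℤ) - 1) = 1
      · rw [hS, Set.indicator_of_mem (hD.2 ⟨hy, hx⟩), Real.exp_add, Real.exp_log (by norm_num)]
        linarith [h2 hy]
      · rw [hS, Set.indicator_of_notMem (fun h => hy (hD.1 h).1), add_zero]
        linarith
    · rw [if_neg hx]
      have e0 : A2.mulVec v 0 = v 0 + v 1 := by simp [A2, Matrix.mulVec, dotProduct]
      have e1 : A2.mulVec v 1 = v 1 := by simp [A2, Matrix.mulVec, dotProduct]
      rw [e0, e1, hS, Set.indicator_of_notMem (fun h => hx (hD.1 h).2), add_zero]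
      exact ⟨by linarith, h1, fun _ => by linarith⟩

lemma opNorm_lower (M : Matrix (Fin 2) (Fin 2) ℝ) :
    M.mulVec ![1,1] 1 ≤ opNorm M * 2 := by
  have h := (Matrix.toEuclideanCLM (𝕜 := ℝ) M).le_opNorm (WithLp.toLp 2 ![1,1])
  have h2 := PiLp.norm_apply_le (Matrix.toEuclideanCLM (𝕜 := ℝ) M (WithLp.toLp 2 ![1,1])) 1
  have h3 : ‖(WithLp.toLp 2 ![1,1] : EuclideanSpace ℝ (Fin 2))‖ ≤ 2 := by
    rw [EuclideanSpace.norm_eq]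
    rw [Real.sqrt_le_left (by norm_num)]
    simp; norm_num
  have h4 : M.mulVec ![1,1] 1 = (Matrix.toEuclideanCLM (𝕜 := ℝ) M (WithLp.toLp 2 ![1,1])) 1 := by
    simp
  rw [h4]
  refine (le_abs_self _).trans (h2.trans (h.trans ?_))
  exact mul_le_mul_of_nonneg_left h3 (norm_nonneg _)

lemma opNorm_exp (n : ℕ) (x : Sigma2) : Real.exp (SS n x) ≤ opNorm (cocycle n x) * 2 :=
  (key n x).2.1.trans (opNorm_lower _)

lemma opNorm_pos_s18 (n : ℕ) (x : Sigma2) : 0 < opNorm (cocycle n x) := by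
  have := opNorm_exp n x
  have := Real.exp_pos (SS n x)
  linarith

lemma log_lower (n : ℕ) (x : Sigma2) :
    SS n x - Real.log 2 ≤ Real.log (opNorm (cocycle n x)) := by
  have h := Real.log_le_log (Real.exp_pos _) (opNorm_exp n x)
  rw [Real.log_exp, Real.log_mul (opNorm_pos_s18 n x).ne' (by norm_num)] at h
  linarith

lemma cont_log (n : ℕ) : Continuous fun x => Real.log (opNorm (cocycle n x)) :=
  (cont_opNorm.comp (cont_cocycle n)).log fun x => (opNorm_pos_s18 n x).ne'

lemma integrable_log (μ : Measure Sigma2) [IsProbabilityMeasure μ] (n : ℕ) :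
    Integrable (fun x => Real.log (opNorm (cocycle n x))) μ :=
  (cont_log n).integrable_of_hasCompactSupport (HasCompactSupport.of_compactSpace _)

lemma meas_D : MeasurableSet D := by
  have : D = (fun x : Sigma2 => x (-1)) ⁻¹' {1} ∩ (fun x : Sigma2 => x 0) ⁻¹' {0} := by
    ext x; simp [D]
  rw [this]
  exact ((measurable_pi_apply _) (measurableSet_singleton _)).inter
    ((measurable_pi_apply _) (measurableSet_singleton _))

lemma integrable_ind (μ : Measure Sigma2) [IsProbabilityMeasure μ]
    (h : MeasurePreserving shift μ μ) (j : ℕ) :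
    Integrable (fun x => D.indicator (fun _ => Real.log 2) (shift^[j] x)) μ :=
  (h.iterate j).integrable_comp_of_integrable ((integrable_const _).indicator meas_D)

lemma integral_comp_iter (μ : Measure Sigma2)
    (h : MeasurePreserving shift μ μ) (j : ℕ) (f : Sigma2 → ℝ) (hf : AEStronglyMeasurable f μ) :
    ∫ x, f (shift^[j] x) ∂μ = ∫ x, f x ∂μ := by
  have hj := h.iterate j
  conv_rhs => rw [← hj.map_eq]
  rw [integral_map hj.measurable.aemeasurable]
  rw [hj.map_eq]; exact hf

lemma integrable_SS (μ : Measure Sigma2) [IsProbabilityMeasure μ]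
    (h : MeasurePreserving shift μ μ) (n : ℕ) : Integrable (SS n) μ :=
  integrable_finset_sum _ fun j _ => integrable_ind μ h j

lemma integral_SS (μ : Measure Sigma2) [IsProbabilityMeasure μ]
    (h : MeasurePreserving shift μ μ) (n : ℕ) :
    ∫ x, SS n x ∂μ = n * ((μ D).toReal * Real.log 2) := by
  unfold SS
  rw [integral_finset_sum _ fun j _ => integrable_ind μ h j]
  rw [Finset.sum_congr rfl fun j _ => integral_comp_iter μ h j _
    ((integrable_const _).indicator meas_D).aestronglyMeasurable]
  rw [integral_indicator_const _ meas_D]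
  simp [Measure.real]

/-- For every shift-invariant ergodic Borel probability measure `μ`
on `Σ = {1,2}^ℤ` with `μ(D) > 0`, the first Lyapunov exponent
`χ(μ, 𝒜) = lim_{n→∞} (1/n) ∫ log ‖𝒜ⁿ(x)‖ dμ(x)` exists and satisfies
`χ(μ, 𝒜) ≥ μ(D) · log 2 > 0`. -/
theorem stmt18 (μ : Measure Sigma2) [IsProbabilityMeasure μ]
    (herg : Ergodic shift μ) (hD : 0 < μ D) :
    ∃ χ : ℝ,
      Tendsto (fun n : ℕ => (∫ x, Real.log (opNorm (cocycle n x)) ∂μ) / n)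
        atTop (nhds χ) ∧
      (μ D).toReal * Real.log 2 ≤ χ ∧
      0 < (μ D).toReal * Real.log 2 := by
  have h := herg.toMeasurePreserving
  set u : ℕ → ℝ := fun n => ∫ x, Real.log (opNorm (cocycle n x)) ∂μ with hu
  set c : ℝ := (μ D).toReal * Real.log 2 with hc
  have hcpos : 0 < c :=
    mul_pos (ENNReal.toReal_pos hD.ne' (measure_ne_top _ _)) (Real.log_pos (by norm_num))
  have hlow : ∀ n : ℕ, n * c - Real.log 2 ≤ u n := by
    intro n
    have h1 : ∫ x, (SS n x - Real.log 2) ∂μ ≤ u n :=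
      integral_mono ((integrable_SS μ h n).sub (integrable_const _)) (integrable_log μ n)
        (log_lower n)
    rw [integral_sub (integrable_SS μ h n) (integrable_const _), integral_SS μ h] at h1
    simpa using h1
  have hsub : Subadditive u := by
    intro m n
    have hi : Integrable (fun x => Real.log (opNorm (cocycle m (shift^[n] x)))) μ :=
      (h.iterate n).integrable_comp_of_integrable (integrable_log μ m)
    have e := integral_comp_iter μ h n (fun x => Real.log (opNorm (cocycle m x)))
      (integrable_log μ m).aestronglyMeasurable
    simp only [hu]
    rw [← e, ← integral_add hi (integrable_log μ n)]
    refine integral_mono (integrable_log μ _) (hi.add (integrable_log μ n)) fun x => ?_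
    simp only [Pi.add_apply]
    rw [← Real.log_mul (opNorm_pos_s18 _ _).ne' (opNorm_pos_s18 _ _).ne']
    refine Real.log_le_log (opNorm_pos_s18 _ _) ?_
    rw [cocycle_add']
    exact opNorm_mul _ _
  have hdiv : ∀ n : ℕ, 0 < n → c - Real.log 2 / n ≤ u n / n := by
    intro n hn
    have hn' : (0:ℝ) < n := by exact_mod_cast hn
    have e : c - Real.log 2 / n = (n * c - Real.log 2) / n := by field_simp
    rw [e]
    exact div_le_div_of_nonneg_right (hlow n) hn'.le
  have hbdd : BddBelow (Set.range fun n : ℕ => u n / n) := by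
    refine ⟨-Real.log 2, ?_⟩
    rintro _ ⟨n, rfl⟩
    have hl : 0 < Real.log 2 := Real.log_pos (by norm_num)
    rcases Nat.eq_zero_or_pos n with rfl | hn
    · simp [hl.le]
    · have h1 : (1:ℝ) ≤ n := by exact_mod_cast hn
      have h2 : Real.log 2 / n ≤ Real.log 2 := div_le_self hl.le h1
      have := hdiv n hn
      simp only
      linarith
  have hlim := hsub.tendsto_lim hbdd
  refine ⟨hsub.lim, hlim, ?_, hcpos⟩
  have hl2 : Tendsto (fun n : ℕ => c - Real.log 2 / n) atTop (nhds (c - 0)) :=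
    tendsto_const_nhds.sub (tendsto_const_div_atTop_nhds_zero_nat _)
  rw [sub_zero] at hl2
  exact le_of_tendsto_of_tendsto hl2 hlim
    ((eventually_gt_atTop 0).mono fun n hn => hdiv n hn)
end
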